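/- arXiv:1211.0105 — 12 statements merged into one kernel-verified Lean document; each statement's English description precedes it below -/
import Mathlib

section
/- Let X be a compact metric space and T : X → X a homeomorphism such that (X,T) is topologically transitive and admits a T-invariant Borel probability measure μ with full support (an E-system). Then (X,T) is syndetically transitive: for every pair of nonempty open sets U,V ⊆ X the set N(U,V) = {n ∈ ℕ : T^n U ∩ V ≠ ∅} is syndetic. -/
open Filter Set Function Topology MeasureTheory

/-- `N(U,V) = {n ∈ ℕ : T^n U ∩ V ≠ ∅}` (with `ℕ = {1,2,…}`). -/
def hitSet {X : Type*} (f : X → X) (U V : Set X) : Set ℕ :=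
  {n | 0 < n ∧ (f^[n] '' U ∩ V).Nonempty}

/-- A set `S ⊆ ℕ` is syndetic if it has bounded gaps. -/
def IsSyndetic (S : Set ℕ) : Prop :=
  ∃ g : ℕ, ∀ n : ℕ, ∃ m ∈ S, n ≤ m ∧ m ≤ n + g

/-- A topologically transitive compact metric system carrying a fully
supported invariant Borel probability measure (an E-system) is syndetically transitive:
every `N(U,V)` with `U,V` nonempty open is syndetic. -/
theorem E_system_syndetically_transitive
    {X : Type*} [MetricSpace X] [CompactSpace X]
    [MeasurableSpace X] [BorelSpace X] (T : X ≃ₜ X)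
    (htrans : ∀ U V : Set X, IsOpen U → U.Nonempty → IsOpen V → V.Nonempty →
      (hitSet (⇑T) U V).Nonempty)
    (μ : Measure X) (hprob : IsProbabilityMeasure μ)
    (hinv : ∀ s : Set X, MeasurableSet s → μ (⇑T ⁻¹' s) = μ s)
    (hfull : ∀ U : Set X, IsOpen U → U.Nonempty → 0 < μ U) :
    ∀ U V : Set X, IsOpen U → U.Nonempty → IsOpen V → V.Nonempty →
      IsSyndetic (hitSet (⇑T) U V) := by
  intro U V hU hUne hV hVne
  have hT : MeasurePreserving (⇑T) μ μ := by
    refine ⟨T.continuous.measurable, ?_⟩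
    ext s hs
    rw [Measure.map_apply T.continuous.measurable hs, hinv s hs]
  obtain ⟨n0, hn0, y, ⟨x, hxU, rfl⟩, hxV⟩ := htrans U V hU hUne hV hVne
  let W : Set X := U ∩ (⇑T)^[n0] ⁻¹' V
  have hWo : IsOpen W := hU.inter (hV.preimage (T.continuous.iterate n0))
  have hWpos : 0 < μ W := hfull W hWo ⟨x, hxU, hxV⟩
  have key : IsSyndetic (hitSet (⇑T) W W) := by
    by_contra hns
    unfold IsSyndetic at hns
    push Not at hns
    have build : ∀ k : ℕ, ∃ s : Finset ℕ, s.card = k ∧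
        (s : Set ℕ).PairwiseDisjoint (fun i => (⇑T)^[i] ⁻¹' W) := by
      intro k
      induction k with
      | zero => exact ⟨∅, rfl, by simp⟩
      | succ k ih =>
        obtain ⟨s, hs, hd⟩ := ih
        obtain ⟨n, hn⟩ := hns (s.sup id + 1)
        have hle : ∀ i ∈ s, i ≤ s.sup id := fun i hi => Finset.le_sup (f := id) hi
        have hnot : n + s.sup id + 1 ∉ s := by
          intro h
          have := hle _ h
          omega
        refine ⟨insert (n + s.sup id + 1) s, by rw [Finset.card_insert_of_notMem hnot, hs], ?_⟩
        rw [Finset.coe_insert]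
        refine hd.insert ?_
        intro i hi _
        have hi' := hle i hi
        rw [Set.disjoint_left]
        intro z hz1 hz2
        have hmem : n + s.sup id + 1 - i ∈ hitSet (⇑T) W W := by
          refine ⟨by omega, (⇑T)^[n + s.sup id + 1] z, ⟨(⇑T)^[i] z, hz2, ?_⟩, hz1⟩
          have he : n + s.sup id + 1 - i + i = n + s.sup id + 1 := by omega
          rw [← Function.iterate_add_apply, he]
        have := hn _ hmem (by omega)
        omega
    obtain ⟨k, hk⟩ := ENNReal.exists_nat_mul_gt hWpos.ne' (ENNReal.one_ne_top)
    obtain ⟨s, hs, hd⟩ := build k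
    have hm : μ (⋃ i ∈ s, (⇑T)^[i] ⁻¹' W) = k * μ W := by
      rw [measure_biUnion_finset hd
        (fun i _ => (hT.iterate i).measurable hWo.measurableSet)]
      rw [Finset.sum_congr rfl
        (fun i _ => (hT.iterate i).measure_preimage hWo.measurableSet.nullMeasurableSet)]
      simp [hs]
    exact absurd (hm ▸ prob_le_one) (not_le.mpr hk)
  obtain ⟨g, hg⟩ := key
  refine ⟨g + n0, fun n => ?_⟩
  obtain ⟨m, ⟨hm0, z, ⟨w, hw, rfl⟩, hz⟩, h1, h2⟩ := hg n
  refine ⟨n0 + m, ⟨by omega, (⇑T)^[n0 + m] w, ⟨w, hw.1, rfl⟩, ?_⟩, by omega, by omega⟩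
  rw [Function.iterate_add_apply]
  exact hz.2
end

section
/- Let X be a separable infinite-dimensional Banach space and T : X → X a continuous linear operator which is syndetically hypercyclic, i.e. for every pair of nonempty open sets U,V ⊆ X the set N(U,V) = {n ∈ ℕ : T^n U ∩ V ≠ ∅} is syndetic. Then T is (topologically) weakly mixing: T × T is topologically transitive on X × X, i.e. for all nonempty open sets U₁,U₂,V₁,V₂ ⊆ X there exists n ∈ ℕ with T^n U₁ ∩ V₁ ≠ ∅ and T^n U₂ ∩ V₂ ≠ ∅. -/
open Filter Set Function Topology

/-- A syndetically hypercyclic operator on a separable infinite-dimensional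
Banach space is topologically weakly mixing. -/
theorem syndeticallyHypercyclic_weaklyMixing
    {X : Type*} [NormedAddCommGroup X] [NormedSpace ℂ X] [CompleteSpace X]
    [TopologicalSpace.SeparableSpace X] (hinf : ¬ FiniteDimensional ℂ X)
    (T : X →L[ℂ] X)
    (hsynd : ∀ U V : Set X, IsOpen U → U.Nonempty → IsOpen V → V.Nonempty →
      IsSyndetic (hitSet (⇑T) U V)) :
    ∀ U₁ U₂ V₁ V₂ : Set X,
      IsOpen U₁ → U₁.Nonempty → IsOpen U₂ → U₂.Nonempty →
      IsOpen V₁ → V₁.Nonempty → IsOpen V₂ → V₂.Nonempty →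
      ∃ n : ℕ, 0 < n ∧ ((⇑T)^[n] '' U₁ ∩ V₁).Nonempty ∧
        ((⇑T)^[n] '' U₂ ∩ V₂).Nonempty := by
  intro U₁ U₂ V₁ V₂ hU₁ nU₁ hU₂ nU₂ hV₁ nV₁ hV₂ nV₂
  have key : ∀ U : Set X, IsOpen U → U.Nonempty →
      ∃ u : X, ∃ e : ℝ, 0 < e ∧ Metric.ball u e ⊆ U := by
    rintro U hU ⟨u, hu⟩
    obtain ⟨e, he, h⟩ := Metric.isOpen_iff.1 hU u hu
    exact ⟨u, e, he, h⟩
  obtain ⟨u₁, a, ha, hu₁⟩ := key U₁ hU₁ nU₁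
  obtain ⟨u₂, b, hb, hu₂⟩ := key U₂ hU₂ nU₂
  obtain ⟨v₁, c, hc, hv₁⟩ := key V₁ hV₁ nV₁
  obtain ⟨v₂, d, hd, hv₂⟩ := key V₂ hV₂ nV₂
  obtain ⟨e, he, hea, heb, hec, hed⟩ : ∃ e : ℝ, 0 < e ∧ e + e ≤ a ∧ e + e ≤ b ∧
      e + e ≤ c ∧ e + e ≤ d := by
    refine ⟨min (min a b) (min c d) / 2, by positivity, ?_, ?_, ?_, ?_⟩ <;>
      rw [add_halves] <;> simp
  have cont : ∀ n : ℕ, Continuous ((⇑T)^[n]) := fun n => T.continuous.iterate n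
  have zero : ∀ n : ℕ, (⇑T)^[n] 0 = 0 := fun n => iterate_map_zero T n
  have hadd : ∀ (n : ℕ) (x y : X), (⇑T)^[n] (x + y) = (⇑T)^[n] x + (⇑T)^[n] y :=
    fun n x y => iterate_map_add T n x y
  have comb : ∀ (u : X) (r : ℝ), e + e ≤ r → ∀ x ∈ Metric.ball u e,
      ∀ z ∈ Metric.ball (0 : X) e, x + z ∈ Metric.ball u r := by
    intro u r hr x hx z hz
    rw [mem_ball_iff_norm] at *
    rw [sub_zero] at hz
    have : x + z - u = (x - u) + z := by abel
    rw [this]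
    linarith [norm_add_le (x - u) z]
  have trans : ∀ p q : X, ∃ k : ℕ,
      (Metric.ball p e ∩ (⇑T)^[k] ⁻¹' Metric.ball q e).Nonempty := by
    intro p q
    obtain ⟨g, hg⟩ := hsynd _ _ (Metric.isOpen_ball (x := p) (ε := e))
      ⟨p, Metric.mem_ball_self he⟩ (Metric.isOpen_ball (x := q) (ε := e))
      ⟨q, Metric.mem_ball_self he⟩
    obtain ⟨k, ⟨-, _, ⟨x, hx, rfl⟩, hk⟩, -⟩ := hg 0
    exact ⟨k, x, hx, hk⟩
  obtain ⟨k, hk⟩ := trans u₁ u₂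
  obtain ⟨l, hl⟩ := trans v₁ v₂
  have oW : IsOpen (Metric.ball (0 : X) e) := Metric.isOpen_ball
  have mW : (0 : X) ∈ Metric.ball (0 : X) e := Metric.mem_ball_self he
  obtain ⟨g, hg⟩ := hsynd (Metric.ball 0 e ∩ (⇑T)^[l] ⁻¹' Metric.ball 0 e) _
    (oW.inter (oW.preimage (cont l))) ⟨0, mW, by rw [mem_preimage, zero]; exact mW⟩
    (Metric.isOpen_ball.inter (Metric.isOpen_ball.preimage (cont l))) hl
  obtain ⟨g', hg'⟩ := hsynd _
    (⋂ j ∈ Finset.range (g + 1), (⇑T)^[j] ⁻¹' (Metric.ball 0 e ∩ (⇑T)^[k] ⁻¹' Metric.ball 0 e))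
    (Metric.isOpen_ball.inter (Metric.isOpen_ball.preimage (cont k))) hk
    (isOpen_biInter_finset fun j _ => (oW.inter (oW.preimage (cont k))).preimage (cont j))
    ⟨0, by
      simp only [mem_iInter, mem_preimage, mem_inter_iff, zero]
      exact fun _ _ => ⟨mW, mW⟩⟩
  obtain ⟨n, ⟨-, _, ⟨x, ⟨hx1, hx2⟩, rfl⟩, hn⟩, -⟩ := hg' 0
  obtain ⟨m, ⟨hm0, _, ⟨z, ⟨hz1, hz2⟩, rfl⟩, hm1, hm2⟩, hnm, hmn⟩ := hg n
  have hxm := mem_iInter₂.1 hn (m - n) (Finset.mem_range.2 (by omega))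
  rw [mem_preimage, ← iterate_add_apply, Nat.sub_add_cancel hnm] at hxm
  obtain ⟨hx3, hx4⟩ := hxm
  rw [mem_preimage] at hx2 hz2 hm2 hx4
  rw [← iterate_add_apply, add_comm, iterate_add_apply] at hx4 hm2
  refine ⟨m, hm0, ⟨_, ⟨x + z, hu₁ (comb _ _ hea _ hx1 _ hz1), rfl⟩, hv₁ ?_⟩,
    ⟨_, ⟨(⇑T)^[k] x + (⇑T)^[l] z, hu₂ (comb _ _ heb _ hx2 _ hz2), rfl⟩, hv₂ ?_⟩⟩
  · rw [hadd, add_comm]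
    exact comb _ _ hec _ hm1 _ hx3
  · rw [hadd, add_comm]
    exact comb _ _ hed _ hm2 _ hx4
end

section
/- Let (X,T) be a Polish dynamical system which is upper-frequently transitive: there exists x₀ ∈ X such that for every nonempty open U ⊆ X the set N(x₀,U) = {n ∈ ℕ : T^n x₀ ∈ U} has positive upper density. Then (X,T) is syndetically transitive: for every pair of nonempty open sets U,V ⊆ X the set N(U,V) = {n ∈ ℕ : T^n U ∩ V ≠ ∅} is syndetic. -/
open Filter Set Function Topology

/-- `N(x,U) = {n ∈ ℕ : T^n x ∈ U}` (with `ℕ = {1,2,…}`). -/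
def hitSetPt {X : Type*} (f : X → X) (x : X) (U : Set X) : Set ℕ :=
  {n | 0 < n ∧ f^[n] x ∈ U}

/-- The upper density `ud(A) = limsup_{N→∞} card(A ∩ [1,N])/N` of a set `A ⊆ ℕ`. -/
noncomputable def upperDensity (A : Set ℕ) : ℝ :=
  Filter.limsup (fun N : ℕ => ((A ∩ Set.Icc 1 N).ncard : ℝ) / N) Filter.atTop

lemma freq_of_upperDensity {A : Set ℕ} (h : 0 < upperDensity A) :
    ∃ c : ℝ, 0 < c ∧ ∃ᶠ N : ℕ in atTop, c * N < ((A ∩ Set.Icc 1 N).ncard : ℝ) := by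
  refine ⟨upperDensity A / 2, by linarith, ?_⟩
  have hcob : IsCoboundedUnder (· ≤ ·) atTop
      (fun N : ℕ => ((A ∩ Set.Icc 1 N).ncard : ℝ) / N) := by
    apply IsBoundedUnder.isCoboundedUnder_le
    exact isBoundedUnder_of ⟨0, fun N => by positivity⟩
  have h1 : upperDensity A / 2 < upperDensity A := by linarith
  have h2 := frequently_lt_of_lt_limsup hcob (show _ < limsup _ _ from h1)
  refine (h2.and_eventually (eventually_gt_atTop 0)).mono ?_
  rintro N ⟨hN, hpos⟩
  have : (0 : ℝ) < N := by exact_mod_cast hpos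
  exact (lt_div_iff₀ this).1 hN

lemma nonempty_of_upperDensity {A : Set ℕ} (h : 0 < upperDensity A) : A.Nonempty := by
  obtain ⟨c, hc, hf⟩ := freq_of_upperDensity h
  obtain ⟨N, hN⟩ := hf.exists
  by_contra hA
  rw [Set.not_nonempty_iff_eq_empty] at hA
  simp [hA] at hN
  have : 0 ≤ c * N := by positivity
  linarith

lemma diff_syndetic {A D : Set ℕ} (h : 0 < upperDensity A)
    (hD : ∀ a ∈ A, ∀ b ∈ A, a < b → b - a ∈ D) : IsSyndetic D := by
  by_contra hns
  unfold IsSyndetic at hns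
  push Not at hns
  have hF : ∀ K : ℕ, ∃ F : Finset ℕ, F.card = K ∧ ∀ s ∈ F, ∀ t ∈ F, s < t → t - s ∉ D := by
    intro K
    induction K with
    | zero => exact ⟨∅, by simp⟩
    | succ K ih =>
      obtain ⟨F, hc, hF⟩ := ih
      have hM : ∀ s ∈ F, s ≤ F.sup id := fun s hs => Finset.le_sup (f := id) hs
      generalize F.sup id = M at hM
      obtain ⟨n, hn⟩ := hns (M + 1)
      have hnot : n + M + 1 ∉ F := fun hh => by have := hM _ hh; omega
      refine ⟨insert (n + M + 1) F, by rw [Finset.card_insert_of_notMem hnot, hc], ?_⟩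
      intro s hs t ht hst hmem
      rw [Finset.mem_insert] at hs ht
      rcases hs with rfl | hs <;> rcases ht with rfl | ht
      · omega
      · have := hM _ ht; omega
      · have h1 := hM _ hs
        have := hn _ hmem (by omega)
        omega
      · exact hF s hs t ht hst hmem
  obtain ⟨c, hc, hf⟩ := freq_of_upperDensity h
  obtain ⟨K, hK⟩ := exists_nat_gt (2 / c)
  rw [div_lt_iff₀ hc] at hK
  obtain ⟨F, hcard, hF⟩ := hF K
  have hM : ∀ s ∈ F, s ≤ F.sup id := fun s hs => Finset.le_sup (f := id) hs
  generalize F.sup id = M at hM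
  obtain ⟨N, hN, hNM⟩ := (hf.and_eventually (eventually_ge_atTop (M + 1))).exists
  classical
  have hfin : (A ∩ Set.Icc 1 N).Finite := (Set.finite_Icc 1 N).inter_of_right A
  set B := hfin.toFinset with hB
  rw [Set.ncard_eq_toFinset_card _ hfin, ← hB] at hN
  have hle : (F ×ˢ B).card ≤ (Finset.Icc 1 (N + M)).card := by
    apply Finset.card_le_card_of_injOn (fun p => p.1 + p.2)
    · rintro ⟨s, a⟩ hp
      simp [hB] at hp
      have := hM s hp.1
      simp
      omega
    · rintro ⟨s, a⟩ hp ⟨t, b⟩ hq heq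
      simp [hB] at hp hq heq
      have key : ∀ s ∈ F, ∀ t ∈ F, ∀ a ∈ A, ∀ b ∈ A, s + a = t + b → ¬ s < t := by
        intro s hs t ht a ha b hb heq hst
        have := hD b hb a ha (by omega)
        rw [show a - b = t - s by omega] at this
        exact hF s hs t ht hst this
      have h1 := key s hp.1 t hq.1 a hp.2.1 b hq.2.1 heq
      have h2 := key t hq.1 s hp.1 b hq.2.1 a hp.2.1 heq.symm
      simp
      omega
  rw [Finset.card_product, hcard, Nat.card_Icc] at hle
  have hle' : (K : ℝ) * B.card ≤ N + M := by
    have : K * B.card ≤ N + M := by omega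
    exact_mod_cast this
  have hNM' : (M : ℝ) + 1 ≤ N := by exact_mod_cast hNM
  have h3 : (K : ℝ) * (c * N) ≤ K * B.card := by gcongr
  have h4 : 2 * (N : ℝ) ≤ K * c * N := by gcongr
  linarith

/-- An upper-frequently transitive Polish dynamical system is syndetically
transitive. -/
theorem upperFrequentlyTransitive_syndeticallyTransitive
    {X : Type*} [TopologicalSpace X] [PolishSpace X] (T : X ≃ₜ X)
    (x₀ : X)
    (hUFT : ∀ U : Set X, IsOpen U → U.Nonempty →
      0 < upperDensity (hitSetPt (⇑T) x₀ U)) :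
    ∀ U V : Set X, IsOpen U → U.Nonempty → IsOpen V → V.Nonempty →
      IsSyndetic (hitSet (⇑T) U V) := by
  intro U V hU hUn hV hVn
  obtain ⟨n, hn, hnU⟩ := nonempty_of_upperDensity (hUFT U hU hUn)
  have hcont : ∀ k : ℕ, Continuous ((⇑T)^[k]) := fun k => T.continuous.iterate k
  obtain ⟨v, hv⟩ := hVn
  obtain ⟨w, hw⟩ := (T.surjective.iterate n) v
  obtain ⟨k, hk, hkV⟩ := nonempty_of_upperDensity
    (hUFT ((⇑T)^[n] ⁻¹' V) (hV.preimage (hcont n)) ⟨w, by simpa [hw] using hv⟩)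
  have hkV' : (⇑T)^[k] ((⇑T)^[n] x₀) ∈ V := by
    rw [← Function.iterate_add_apply, add_comm, Function.iterate_add_apply]
    exact hkV
  have hW := hUFT (U ∩ (⇑T)^[k] ⁻¹' V) (hU.inter (hV.preimage (hcont k))) ⟨_, hnU, hkV'⟩
  obtain ⟨g, hg⟩ := diff_syndetic (D := {d | d + k ∈ hitSet (⇑T) U V}) hW (by
    rintro a ⟨-, haU, -⟩ b ⟨-, -, hbV⟩ hab
    refine ⟨by omega, (⇑T)^[b] ((⇑T)^[k] x₀), ⟨(⇑T)^[a] x₀, haU, ?_⟩, ?_⟩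
    · rw [← Function.iterate_add_apply, ← Function.iterate_add_apply]
      rw [show b - a + k + a = b + k by omega]
    · rw [← Function.iterate_add_apply, add_comm, Function.iterate_add_apply]
      exact hbV)
  refine ⟨g + k, fun n => ?_⟩
  obtain ⟨m, hm, h1, h2⟩ := hg n
  exact ⟨m + k, hm, by omega, by omega⟩
end

section
/- Let (X,T) be a topologically transitive Polish dynamical system admitting a fixed point p ∈ X (T p = p). Then for every nonempty open set U ⊆ X, every nonempty open set V ⊆ X, and every open neighborhood W of p, the sets N(U,W) = {n ∈ ℕ : T^n U ∩ W ≠ ∅} and N(W,V) = {n ∈ ℕ : T^n W ∩ V ≠ ∅} are thick. -/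
open Filter Set Function Topology

/-- A set `L ⊆ ℕ` is thick if it contains arbitrarily long intervals of consecutive
integers. -/
def IsThick (L : Set ℕ) : Prop :=
  ∀ l : ℕ, ∃ a : ℕ, Set.Icc a (a + l) ⊆ L

/-- In a topologically transitive Polish dynamical system with a fixed point
`p`, for all nonempty open sets `U, V` and every open neighborhood `W` of `p`, the sets
`N(U,W)` and `N(W,V)` are thick. -/
theorem thick_hitSets_of_fixedPoint
    {X : Type*} [TopologicalSpace X] [PolishSpace X] (T : X ≃ₜ X)
    (htrans : ∀ U V : Set X, IsOpen U → U.Nonempty → IsOpen V → V.Nonempty →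
      (hitSet (⇑T) U V).Nonempty)
    (p : X) (hp : T p = p) :
    ∀ U V W : Set X, IsOpen U → U.Nonempty → IsOpen V → V.Nonempty →
      IsOpen W → p ∈ W →
      IsThick (hitSet (⇑T) U W) ∧ IsThick (hitSet (⇑T) W V) := by
  intro U V W hU hUn hV hVn hW hpW
  have key : ∀ S : X ≃ₜ X, S p = p → ∀ l : ℕ,
      IsOpen (⋂ i ∈ Set.Iic l, (⇑S)^[i] ⁻¹' W) ∧ p ∈ (⋂ i ∈ Set.Iic l, (⇑S)^[i] ⁻¹' W) := by
    intro S hS l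
    refine ⟨(Set.finite_Iic l).isOpen_biInter fun i _ => hW.preimage (S.continuous.iterate i), ?_⟩
    simp only [Set.mem_iInter, Set.mem_preimage]
    intro i _
    rw [Function.iterate_fixed hS]
    exact hpW
  have hps : T.symm p = p := by
    rw [Homeomorph.symm_apply_eq, hp]
  constructor
  · intro l
    obtain ⟨ho, hm⟩ := key T hp l
    obtain ⟨n, hn, y, ⟨x, hx, rfl⟩, hy⟩ := htrans U _ hU hUn ho ⟨p, hm⟩
    refine ⟨n, fun m hm => ?_⟩
    obtain ⟨i, rfl⟩ := Nat.exists_eq_add_of_le hm.1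
    have hi : i ≤ l := by have := hm.2; omega
    simp only [Set.mem_iInter, Set.mem_preimage] at hy
    refine ⟨by omega, _, ⟨x, hx, rfl⟩, ?_⟩
    rw [add_comm, Function.iterate_add_apply]
    exact hy i hi
  · intro l
    obtain ⟨ho, hm⟩ := key T.symm hps l
    obtain ⟨n, hn, y, ⟨x, hx, rfl⟩, hy⟩ := htrans _ V ho ⟨p, hm⟩ hV hVn
    refine ⟨n, fun m hm => ?_⟩
    obtain ⟨i, rfl⟩ := Nat.exists_eq_add_of_le hm.1
    have hi : i ≤ l := by have := hm.2; omega
    simp only [Set.mem_iInter, Set.mem_preimage] at hx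
    refine ⟨by omega, _, ⟨_, hx i hi, rfl⟩, ?_⟩
    have hinv : Function.RightInverse (⇑T.symm) (⇑T) := T.apply_symm_apply
    rw [Function.iterate_add_apply, hinv.iterate i x]
    exact hy
end

section
/- Let (X,T) be a Polish dynamical system which is lower-frequently transitive: there exists x₀ ∈ X such that for every nonempty open U ⊆ X the set N(x₀,U) = {n ∈ ℕ : T^n x₀ ∈ U} has positive lower density. Let J : X → X̃ be any dynamical compactification of (X,T), with compact metric system (X̃,T̃). Then there exist a T̃-invariant Borel probability measure μ on X̃ with full support (supp(μ) = X̃) and a strictly increasing sequence (n_k) in ℕ such that the averaged orbit measures (1/n_k) Σ_{j=1}^{n_k} δ_{T̃^j(J x₀)} converge to μ in the weak* topology; in particular J x₀ is a quasi-generic point for μ. -/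
open Filter Set Function Topology MeasureTheory

/-- The lower density `ld(A) = liminf_{N→∞} card(A ∩ [1,N])/N` of a set `A ⊆ ℕ`. -/
noncomputable def lowerDensity (A : Set ℕ) : ℝ :=
  Filter.liminf (fun N : ℕ => ((A ∩ Set.Icc 1 N).ncard : ℝ) / N) Filter.atTop

noncomputable def avgM {Y : Type*} [MeasurableSpace Y] (u : ℕ → Y) (n : ℕ) : Measure Y :=
  ((n + 1 : ℕ) : ENNReal)⁻¹ • ∑ j ∈ Finset.Icc 1 (n + 1), Measure.dirac (u j)

theorem avgM_prob {Y : Type*} [MeasurableSpace Y] (u : ℕ → Y) (n : ℕ) :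
    IsProbabilityMeasure (avgM u n) := by
  constructor
  simp only [avgM, Measure.smul_apply, Measure.finsetSum_apply, measure_univ, Finset.sum_const,
    Nat.card_Icc, smul_eq_mul, nsmul_eq_mul, mul_one, Nat.add_sub_cancel]
  exact ENNReal.inv_mul_cancel (by simp) (ENNReal.natCast_ne_top _)

theorem avgM_integral {Y : Type*} [MetricSpace Y] [CompactSpace Y] [MeasurableSpace Y]
    [BorelSpace Y] (u : ℕ → Y) (n : ℕ) (f : C(Y, ℝ)) :
    ∫ y, f y ∂(avgM u n) = (∑ j ∈ Finset.Icc 1 (n + 1), f (u j)) / ((n + 1 : ℕ) : ℝ) := by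
  rw [avgM, integral_smul_measure, integral_finsetSum_measure]
  · simp only [integral_dirac, ENNReal.toReal_inv, ENNReal.toReal_natCast, smul_eq_mul]
    rw [div_eq_inv_mul]
  · intro i _
    exact integrable_dirac (by simp)

/-- If `(X,T)` is a lower-frequently transitive Polish system with LFT point
`x₀`, then for any dynamical compactification `J : X → Y` (with `Y` compact metric,
`S : Y → Y` continuous, `J` a dense embedding intertwining `T` and `S`) there exist an
`S`-invariant fully supported Borel probability measure `μ` on `Y` and a strictly
increasing sequence `(n_k)` such that the averaged orbit measures
`(1/n_k) ∑_{j=1}^{n_k} δ_{S^j(J x₀)}` converge to `μ` in the weak* topology: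
`J x₀` is quasi-generic for `μ`. -/
theorem lowerFrequentlyTransitive_quasiGeneric_fullSupport
    {X Y : Type*} [TopologicalSpace X] [PolishSpace X]
    [MetricSpace Y] [CompactSpace Y] [MeasurableSpace Y] [BorelSpace Y]
    (T : X ≃ₜ X) (S : Y → Y) (hS : Continuous S)
    (J : X → Y) (hJ : IsEmbedding J) (hJdense : DenseRange J)
    (hequi : ∀ x : X, S (J x) = J (T x))
    (x₀ : X)
    (hLFT : ∀ U : Set X, IsOpen U → U.Nonempty →
      0 < lowerDensity (hitSetPt (⇑T) x₀ U)) :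
    ∃ μ : Measure Y, IsProbabilityMeasure μ ∧
      (∀ s : Set Y, MeasurableSet s → μ (S ⁻¹' s) = μ s) ∧
      (∀ V : Set Y, IsOpen V → V.Nonempty → 0 < μ V) ∧
      ∃ n : ℕ → ℕ, StrictMono n ∧
        ∀ f : C(Y, ℝ),
          Tendsto (fun k : ℕ => (∑ j ∈ Finset.Icc 1 (n k), f (S^[j] (J x₀))) / (n k : ℝ))
            atTop (nhds (∫ y, f y ∂μ)) := by
  have hiter : ∀ n, S^[n] (J x₀) = J (T^[n] x₀) := by
    intro n
    induction n with
    | zero => rfl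
    | succ k ih => rw [iterate_succ_apply', iterate_succ_apply', ih, hequi]
  set u : ℕ → Y := fun j => S^[j] (J x₀) with hu
  obtain ⟨ν, φ, hφ, hlim⟩ := CompactSpace.tendsto_subseq (X := ProbabilityMeasure Y)
    (fun n => ⟨avgM u n, avgM_prob u n⟩)
  have hconv : ∀ f : C(Y, ℝ),
      Tendsto (fun k : ℕ => (∑ j ∈ Finset.Icc 1 (φ k + 1), f (S^[j] (J x₀))) /
        ((φ k + 1 : ℕ) : ℝ)) atTop (nhds (∫ y, f y ∂(ν : Measure Y))) := by
    intro f
    have h := (ProbabilityMeasure.tendsto_iff_forall_integral_tendsto.1 hlim)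
      (BoundedContinuousFunction.mkOfCompact f)
    refine h.congr fun k => ?_
    exact avgM_integral u (φ k) f
  have hn : StrictMono (fun k => φ k + 1) := fun a b hab => Nat.add_lt_add_right (hφ hab) 1
  refine ⟨ν, inferInstance, ?_, ?_, fun k => φ k + 1, hn, hconv⟩
  · have key : (ν : Measure Y).map S = ν := by
      haveI : IsProbabilityMeasure ((ν : Measure Y).map S) :=
        Measure.isProbabilityMeasure_map hS.measurable.aemeasurable
      apply ext_of_forall_integral_eq_of_IsFiniteMeasure
      intro f
      rw [integral_map hS.measurable.aemeasurable f.continuous.aestronglyMeasurable]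
      have h1 := hconv ⟨fun y => f (S y), f.continuous.comp hS⟩
      have h2 := hconv f.toContinuousMap
      have h3 := h1.sub h2
      have h4 : Tendsto (fun k : ℕ => (2 * ‖f‖) / ((φ k + 1 : ℕ) : ℝ)) atTop (nhds 0) :=
        tendsto_const_nhds.div_atTop (tendsto_natCast_atTop_atTop.comp hn.tendsto_atTop)
      have h5 := tendsto_nhds_unique h3 (squeeze_zero_norm (fun k => ?_) h4)
      · exact sub_eq_zero.1 h5
      · have tel : ∀ m : ℕ, ∑ j ∈ Finset.Icc 1 m, f (S (S^[j] (J x₀))) -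
            ∑ j ∈ Finset.Icc 1 m, f (S^[j] (J x₀)) =
            f (S^[m + 1] (J x₀)) - f (S^[1] (J x₀)) := by
          intro m
          induction m with
          | zero => simp
          | succ m ih =>
            rw [Finset.sum_Icc_succ_top (by omega), Finset.sum_Icc_succ_top (by omega),
              iterate_succ_apply' S (m + 1)]
            linarith
        have hb := norm_sub_le (f (S^[φ k + 1 + 1] (J x₀))) (f (S^[1] (J x₀)))
        have hb1 := f.norm_coe_le_norm (S^[φ k + 1 + 1] (J x₀))
        have hb2 := f.norm_coe_le_norm (S^[1] (J x₀))
        have := tel (φ k + 1)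
        rw [← sub_div, norm_div, Real.norm_natCast]
        refine div_le_div_of_nonneg_right ?_ (Nat.cast_nonneg _)
        change ‖∑ j ∈ Finset.Icc 1 (φ k + 1), f (S (S^[j] (J x₀))) -
            ∑ j ∈ Finset.Icc 1 (φ k + 1), f (S^[j] (J x₀))‖ ≤ _
        rw [this]
        linarith
    intro s hs
    rw [← Measure.map_apply hS.measurable hs, key]
  · intro V hV hVne
    obtain ⟨x, hx⟩ := hJdense.exists_mem_open hV hVne
    obtain ⟨r, hr, hball⟩ := Metric.isOpen_iff.1 hV _ hx
    have hd := hLFT (J ⁻¹' Metric.ball (J x) (r / 2))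
      (Metric.isOpen_ball.preimage hJ.continuous) ⟨x, by simpa using hr⟩
    obtain ⟨c, hc, hcd⟩ := exists_between hd
    have hev := eventually_lt_of_lt_liminf hcd
      (isBoundedUnder_of ⟨0, fun N => by positivity⟩)
    let f : C(Y, ℝ) := ⟨fun z => max 0 (2 - 2 * dist z (J x) / r), by fun_prop⟩
    have hf0 : ∀ z, 0 ≤ f z := fun z => le_max_left _ _
    have hf1 : ∀ z ∈ Metric.ball (J x) (r / 2), 1 ≤ f z := by
      intro z hz
      refine le_max_of_le_right ?_
      have : 2 * dist z (J x) / r ≤ 1 := by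
        rw [div_le_one hr]
        have := Metric.mem_ball.1 hz
        linarith
      linarith
    have hfV : ∀ z, z ∉ V → f z = 0 := by
      intro z hz
      refine max_eq_left ?_
      have : 1 ≤ dist z (J x) / r := by
        rw [one_le_div hr]
        by_contra hcon
        exact hz (hball (Metric.mem_ball.2 (not_le.1 hcon)))
      rw [mul_div_assoc]
      linarith
    have hint : c ≤ ∫ y, f y ∂(ν : Measure Y) := by
      refine ge_of_tendsto (hconv f) ?_
      filter_upwards [hn.tendsto_atTop.eventually hev] with k hk
      refine hk.le.trans (div_le_div_of_nonneg_right ?_ (Nat.cast_nonneg _))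
      generalize φ k + 1 = m
      classical
      have hset : hitSetPt (⇑T) x₀ (J ⁻¹' Metric.ball (J x) (r / 2)) ∩ Set.Icc 1 m =
          ((Finset.Icc 1 m).filter
            (fun j => S^[j] (J x₀) ∈ Metric.ball (J x) (r / 2)) : Finset ℕ) := by
        ext j
        simp only [hitSetPt, Set.mem_inter_iff, Set.mem_setOf_eq, Set.mem_preimage, Set.mem_Icc,
          Finset.coe_filter, Finset.mem_Icc, hiter]
        constructor
        · rintro ⟨⟨_, h1⟩, h2⟩
          exact ⟨h2, h1⟩
        · rintro ⟨h2, h1⟩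
          exact ⟨⟨h2.1, h1⟩, h2⟩
      rw [hset, Set.ncard_coe_finset, Finset.card_filter]
      push_cast
      refine Finset.sum_le_sum fun j _ => ?_
      split_ifs with h
      · exact hf1 _ h
      · exact hf0 _
    rw [pos_iff_ne_zero]
    intro h0
    have : ∫ y, f y ∂(ν : Measure Y) = 0 := by
      refine integral_eq_zero_of_ae ?_
      have hae : ∀ᵐ y ∂(ν : Measure Y), y ∉ V := measure_eq_zero_iff_ae_notMem.1 h0
      filter_upwards [hae] with y hy
      exact hfV y hy
    linarith
end

section
/- Let (X,T) be a Polish dynamical system admitting a dynamical compactification J : X → X̃, with compact metric system (X̃,T̃), such that on X̃ there is a T̃-invariant Borel probability measure μ with full support (supp(μ) = X̃) for which some point J x₀ with x₀ ∈ X is quasi-generic: for some strictly increasing sequence (n_k) the measures (1/n_k) Σ_{j=1}^{n_k} δ_{T̃^j(J x₀)} converge to μ in the weak* topology. Then (X,T) is upper-frequently transitive; in fact for every nonempty open U ⊆ X the set N(x₀,U) = {n ∈ ℕ : T^n x₀ ∈ U} has positive upper density. -/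
open Filter Set Function Topology MeasureTheory

/-- If a Polish system `(X,T)` admits a dynamical compactification
`J : X → Y` carrying an invariant fully supported Borel probability measure `μ` for which
`J x₀` (with `x₀ ∈ X`) is quasi-generic, then `(X,T)` is upper-frequently transitive: for
every nonempty open `U ⊆ X` the set `N(x₀,U)` has positive upper density. -/
theorem upperFrequentlyTransitive_of_quasiGeneric
    {X Y : Type*} [TopologicalSpace X] [PolishSpace X]
    [MetricSpace Y] [CompactSpace Y] [MeasurableSpace Y] [BorelSpace Y]
    (T : X ≃ₜ X) (S : Y → Y) (hS : Continuous S)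
    (J : X → Y) (hJ : IsEmbedding J) (hJdense : DenseRange J)
    (hequi : ∀ x : X, S (J x) = J (T x))
    (μ : Measure Y) (hprob : IsProbabilityMeasure μ)
    (hinv : ∀ s : Set Y, MeasurableSet s → μ (S ⁻¹' s) = μ s)
    (hfull : ∀ V : Set Y, IsOpen V → V.Nonempty → 0 < μ V)
    (x₀ : X) (n : ℕ → ℕ) (hn : StrictMono n)
    (hconv : ∀ f : C(Y, ℝ),
      Tendsto (fun k : ℕ => (∑ j ∈ Finset.Icc 1 (n k), f (S^[j] (J x₀))) / (n k : ℝ))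
        atTop (nhds (∫ y, f y ∂μ))) :
    ∀ U : Set X, IsOpen U → U.Nonempty → 0 < upperDensity (hitSetPt (⇑T) x₀ U) := by
  intro U hU hUne
  obtain ⟨V, hV, rfl⟩ := hJ.isOpen_iff.1 hU
  obtain ⟨u, hu⟩ := hUne
  obtain ⟨r, hr, hball⟩ := Metric.isOpen_iff.1 hV (J u) hu
  have hiter : ∀ j : ℕ, S^[j] (J x₀) = J ((⇑T)^[j] x₀) := by
    intro j
    induction j with
    | zero => rfl
    | succ k ih => rw [iterate_succ_apply', iterate_succ_apply', ih, hequi]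
  let f : C(Y, ℝ) := ⟨fun z => max 0 (1 - dist z (J u) / r), by fun_prop⟩
  have hf : ∀ z, f z = max 0 (1 - dist z (J u) / r) := fun z => rfl
  have hf0 : ∀ z, 0 ≤ f z := fun z => le_max_left _ _
  have hf1 : ∀ z, f z ≤ 1 := by
    intro z
    rw [hf]
    refine max_le zero_le_one ?_
    have : 0 ≤ dist z (J u) / r := by positivity
    linarith
  have hfV : ∀ z, z ∉ V → f z = 0 := by
    intro z hz
    rw [hf]
    refine max_eq_left ?_
    have h1 : r ≤ dist z (J u) := by
      by_contra h
      exact hz (hball (by simpa using h))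
    have : 1 ≤ dist z (J u) / r := (one_le_div hr).2 h1
    linarith
  haveI : μ.IsOpenPosMeasure := ⟨fun W hW hWne => (hfull W hW hWne).ne'⟩
  have hpos : 0 < ∫ y, f y ∂μ := by
    refine f.continuous.integral_pos_of_hasCompactSupport_nonneg_nonzero
      (HasCompactSupport.of_compactSpace _) hf0 (x := J u) ?_
    rw [hf]; simp
  set c := ∫ y, f y ∂μ
  have hev := (hconv f).eventually (lt_mem_nhds (half_lt_self hpos))
  have key : ∀ N : ℕ, (∑ j ∈ Finset.Icc 1 N, f (S^[j] (J x₀)))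
      ≤ ((hitSetPt (⇑T) x₀ (J ⁻¹' V) ∩ Set.Icc 1 N).ncard : ℝ) := by
    intro N
    classical
    have hset : hitSetPt (⇑T) x₀ (J ⁻¹' V) ∩ Set.Icc 1 N
        = ((Finset.Icc 1 N).filter (fun j => S^[j] (J x₀) ∈ V) : Finset ℕ) := by
      ext j
      simp only [hitSetPt, Set.mem_inter_iff, Set.mem_setOf_eq, Set.mem_preimage, Set.mem_Icc,
        Finset.coe_filter, Finset.mem_Icc, hiter]
      constructor
      · rintro ⟨⟨_, h⟩, h2⟩; exact ⟨h2, h⟩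
      · rintro ⟨h2, h⟩; exact ⟨⟨h2.1, h⟩, h2⟩
    rw [hset, Set.ncard_coe_finset, Finset.card_filter]
    push_cast
    refine Finset.sum_le_sum fun j _ => ?_
    split_ifs with h
    · exact hf1 _
    · exact (hfV _ h).le
  have hfreq : ∃ᶠ N : ℕ in atTop, c / 2 ≤
      ((hitSetPt (⇑T) x₀ (J ⁻¹' V) ∩ Set.Icc 1 N).ncard : ℝ) / N := by
    refine hn.tendsto_atTop.frequently (Eventually.frequently ?_)
    filter_upwards [hev] with k hk
    refine hk.le.trans ?_
    gcongr
    exact key _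
  have hbdd : IsBoundedUnder (· ≤ ·) atTop (fun N : ℕ =>
      ((hitSetPt (⇑T) x₀ (J ⁻¹' V) ∩ Set.Icc 1 N).ncard : ℝ) / N) := by
    refine isBoundedUnder_of ⟨1, fun N => ?_⟩
    refine div_le_one_of_le₀ ?_ (Nat.cast_nonneg _)
    have := Set.ncard_le_ncard (s := hitSetPt (⇑T) x₀ (J ⁻¹' V) ∩ Set.Icc 1 N)
      Set.inter_subset_right (Set.finite_Icc 1 N)
    rw [← Finset.coe_Icc, Set.ncard_coe_finset, Nat.card_Icc, Nat.add_sub_cancel,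
      Finset.coe_Icc] at this
    exact_mod_cast this
  exact (half_pos hpos).trans_le (le_limsup_of_frequently_le hfreq hbdd)
end

section
/- Let X and Y be compact metric spaces, T : X → X and S : Y → Y continuous maps, and π : X → Y a continuous surjection with π ∘ T = S ∘ π. Assume π is irreducible: for every closed subset Z ⊆ X, π(Z) = Y implies Z = X. If ν is an S-invariant Borel probability measure on Y with full support, then there exists a T-invariant Borel probability measure μ on X with π_*μ = ν and with full support (supp(μ) = X). -/
open Filter Set Function Topology MeasureTheory

open scoped CompactlySupported BoundedContinuousFunction

/-- Positivity: if `g ∘ π + f ∘ T - f ≥ 0` then `∫ g ≥ 0`. -/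
lemma aux_integral_nonneg
    {X Y : Type*} [MetricSpace X] [CompactSpace X]
    [MetricSpace Y] [CompactSpace Y] [MeasurableSpace Y] [BorelSpace Y]
    (T : X → X) (S : Y → Y) (hS : Continuous S)
    (π : X → Y) (hπs : Function.Surjective π)
    (hcomm : π ∘ T = S ∘ π) (ν : Measure Y) [IsProbabilityMeasure ν]
    (hmp : MeasurePreserving S ν ν) (g : C(Y, ℝ)) (f : C(X, ℝ))
    (h : ∀ x, 0 ≤ g (π x) + (f (T x) - f x)) : 0 ≤ ∫ y, g y ∂ν := by
  have hsc : Function.Semiconj π T S := fun x => congrFun hcomm x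
  have hint : ∀ k : ℕ, Integrable (fun y => g (S^[k] y)) ν := fun k =>
    (hmp.iterate k).integrable_comp_of_integrable
      (g.continuous.integrable_of_hasCompactSupport (HasCompactSupport.of_compactSpace _))
  have hint2 : ∀ k : ℕ, ∫ y, g (S^[k] y) ∂ν = ∫ y, g y ∂ν := by
    intro k
    have hm := hmp.iterate k
    conv_rhs => rw [← hm.map_eq]
    rw [integral_map hm.measurable.aemeasurable g.continuous.aestronglyMeasurable]
  have key : ∀ (n : ℕ) (x : X),
      0 ≤ (∑ k ∈ Finset.range n, g (S^[k] (π x))) + (f (T^[n] x) - f x) := by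
    intro n x
    induction n with
    | zero => simp
    | succ n ih =>
      have h1 := h (T^[n] x)
      rw [hsc.iterate_right n x] at h1
      rw [Finset.sum_range_succ, Function.iterate_succ_apply']
      linarith
  have key2 : ∀ (n : ℕ) (y : Y), -(2 * ‖f‖) ≤ ∑ k ∈ Finset.range n, g (S^[k] y) := by
    intro n y
    obtain ⟨x, rfl⟩ := hπs y
    have h1 := key n x
    have h2 := (abs_le.1 (f.norm_coe_le_norm (T^[n] x))).2
    have h3 := (abs_le.1 (f.norm_coe_le_norm x)).1
    linarith
  have key3 : ∀ n : ℕ, -(2 * ‖f‖) ≤ n * ∫ y, g y ∂ν := by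
    intro n
    have h1 : ∫ y, -(2 * ‖f‖) ∂ν ≤ ∫ y, ∑ k ∈ Finset.range n, g (S^[k] y) ∂ν :=
      integral_mono (integrable_const _) (integrable_finsetSum _ fun k _ => hint k) (key2 n)
    rw [integral_finsetSum _ fun k _ => hint k] at h1
    simpa [hint2] using h1
  by_contra hneg
  push Not at hneg
  obtain ⟨n, hn⟩ := exists_nat_gt ((2 * ‖f‖) / (-∫ y, g y ∂ν))
  rw [div_lt_iff₀ (by linarith)] at hn
  have := key3 n
  linarith

/-- The functional on `C(X, ℝ)`. -/
lemma aux_exists_functional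
    {X Y : Type*} [MetricSpace X] [CompactSpace X]
    [MetricSpace Y] [CompactSpace Y] [MeasurableSpace Y] [BorelSpace Y]
    (T : X → X) (hT : Continuous T) (S : Y → Y) (hS : Continuous S)
    (π : X → Y) (hπc : Continuous π) (hπs : Function.Surjective π)
    (hcomm : π ∘ T = S ∘ π) (ν : Measure Y) [IsProbabilityMeasure ν]
    (hmp : MeasurePreserving S ν ν) :
    ∃ Λ : C(X, ℝ) →ₗ[ℝ] ℝ, (∀ f, 0 ≤ f → 0 ≤ Λ f) ∧
      (∀ f : C(X, ℝ), Λ (f.comp ⟨T, hT⟩) = Λ f) ∧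
      (∀ g : C(Y, ℝ), Λ (g.comp ⟨π, hπc⟩) = ∫ y, g y ∂ν) := by
  have hi : ∀ g : C(Y, ℝ), Integrable (fun y => g y) ν := fun g =>
    g.continuous.integrable_of_hasCompactSupport (HasCompactSupport.of_compactSpace _)
  let L : C(Y, ℝ) × C(X, ℝ) →ₗ[ℝ] C(X, ℝ) :=
    { toFun := fun p => p.1.comp ⟨π, hπc⟩ + (p.2.comp ⟨T, hT⟩ - p.2)
      map_add' := by intro p q; ext x; simp; ring
      map_smul' := by intro c p; ext x; simp; ring }
  let I : C(Y, ℝ) × C(X, ℝ) →ₗ[ℝ] ℝ :=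
    { toFun := fun p => ∫ y, p.1 y ∂ν
      map_add' := by intro p q; simpa using integral_add (hi p.1) (hi q.1)
      map_smul' := by intro c p; simpa using integral_const_mul c (fun y => p.1 y) }
  have hpos : ∀ p, 0 ≤ L p → 0 ≤ I p := fun p hp =>
    aux_integral_nonneg T S hS π hπs hcomm ν hmp p.1 p.2 (fun x => hp x)
  have hI : I ∈ LinearMap.range L.dualMap := by
    rw [LinearMap.range_dualMap_eq_dualAnnihilator_ker, Submodule.mem_dualAnnihilator]
    intro p hp
    have hp' : L p = 0 := hp
    have h1 := hpos p hp'.ge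
    have h2 := hpos (-p) (by rw [map_neg, hp', neg_zero])
    rw [map_neg] at h2
    linarith
  obtain ⟨φ, hφ⟩ := hI
  have hφ' : ∀ p, φ (L p) = I p := fun p => by rw [← hφ]; rfl
  obtain ⟨Λ, hΛ1, hΛ2⟩ := riesz_extension (PointedCone.positive ℝ C(X, ℝ))
    ⟨LinearMap.range L, φ.comp (LinearMap.range L).subtype⟩
    (by
      rintro ⟨_, p, rfl⟩ hp
      have := hpos p (by simpa using hp)
      rw [← hφ'] at this
      exact this)
    (by
      intro f
      refine ⟨⟨_, (ContinuousMap.const Y ‖f‖, 0), rfl⟩, ?_⟩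
      rw [PointedCone.mem_positive]
      intro x
      have h3 := (abs_le.1 (f.norm_coe_le_norm x)).1
      simp [L]
      linarith)
  have hΛL : ∀ p, Λ (L p) = I p := fun p => (hΛ1 ⟨_, p, rfl⟩).trans (hφ' p)
  refine ⟨Λ, fun f hf => hΛ2 f (by simpa using hf), fun f => ?_, fun g => ?_⟩
  · have h1 := hΛL (0, f)
    have h2 : L (0, f) = f.comp ⟨T, hT⟩ - f := by ext x; simp [L]
    rw [h2, map_sub] at h1
    have h3 : I (0, f) = 0 := by simp [I]
    linarith
  · have h1 := hΛL (g, 0)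
    have h2 : L (g, 0) = g.comp ⟨π, hπc⟩ := by ext x; simp [L]
    rw [h2] at h1
    exact h1

/-- Riesz representation on a compact space. -/
lemma aux_exists_measure {X : Type*} [MetricSpace X] [CompactSpace X] [MeasurableSpace X]
    [BorelSpace X] (Λ : C(X, ℝ) →ₗ[ℝ] ℝ) (hΛ : ∀ f, 0 ≤ f → 0 ≤ Λ f) :
    ∃ μ : Measure X, IsFiniteMeasure μ ∧ ∀ f : C(X, ℝ), ∫ x, f x ∂μ = Λ f := by
  let J : C_c(X, ℝ) →ₗ[ℝ] C(X, ℝ) :=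
    { toFun := fun f => f.toContinuousMap
      map_add' := by intro f g; rfl
      map_smul' := by intro c f; rfl }
  let P : C_c(X, ℝ) →ₚ[ℝ] ℝ := PositiveLinearMap.mk₀ (Λ.comp J) (fun f hf => hΛ _ (fun x => hf x))
  refine ⟨RealRMK.rieszMeasure P, inferInstance, fun f => ?_⟩
  exact RealRMK.integral_rieszMeasure P (CompactlySupportedContinuousMap.continuousMapEquiv f)

/-- Let `π : X → Y` be an irreducible factor map between compact metric
systems `(X,T)` and `(Y,S)`. If `ν` is an `S`-invariant fully supported Borel probability
measure on `Y`, then there is a `T`-invariant Borel probability measure `μ` on `X` with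
`π_*μ = ν` and full support. -/
theorem exists_fullySupported_invariant_lift_of_irreducible
    {X Y : Type*} [MetricSpace X] [CompactSpace X] [MeasurableSpace X] [BorelSpace X]
    [MetricSpace Y] [CompactSpace Y] [MeasurableSpace Y] [BorelSpace Y]
    (T : X → X) (hT : Continuous T) (S : Y → Y) (hS : Continuous S)
    (π : X → Y) (hπc : Continuous π) (hπs : Function.Surjective π)
    (hcomm : π ∘ T = S ∘ π)
    (hirr : ∀ Z : Set X, IsClosed Z → π '' Z = Set.univ → Z = Set.univ)
    (ν : Measure Y) (hνprob : IsProbabilityMeasure ν)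
    (hνinv : ∀ s : Set Y, MeasurableSet s → ν (S ⁻¹' s) = ν s)
    (hνfull : ∀ V : Set Y, IsOpen V → V.Nonempty → 0 < ν V) :
    ∃ μ : Measure X, IsProbabilityMeasure μ ∧
      (∀ s : Set X, MeasurableSet s → μ (T ⁻¹' s) = μ s) ∧
      μ.map π = ν ∧
      (∀ U : Set X, IsOpen U → U.Nonempty → 0 < μ U) := by
  have hmp : MeasurePreserving S ν ν :=
    ⟨hS.measurable, by ext s hs; rw [Measure.map_apply hS.measurable hs, hνinv s hs]⟩
  obtain ⟨Λ, hpos, hinv, hpush⟩ :=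
    aux_exists_functional T hT S hS π hπc hπs hcomm ν hmp
  obtain ⟨μ, hfin, hμ⟩ := aux_exists_measure Λ hpos
  have hmap : μ.map π = ν := by
    refine ext_of_forall_integral_eq_of_IsFiniteMeasure fun g => ?_
    rw [integral_map hπc.measurable.aemeasurable g.continuous.aestronglyMeasurable]
    exact (hμ (g.toContinuousMap.comp ⟨π, hπc⟩)).trans (hpush g.toContinuousMap)
  have hTmap : μ.map T = μ := by
    refine ext_of_forall_integral_eq_of_IsFiniteMeasure fun f => ?_
    rw [integral_map hT.measurable.aemeasurable f.continuous.aestronglyMeasurable]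
    exact (hμ (f.toContinuousMap.comp ⟨T, hT⟩)).trans
      ((hinv f.toContinuousMap).trans (hμ f.toContinuousMap).symm)
  refine ⟨μ, ⟨?_⟩, fun s hs => ?_, hmap, fun U hU hUne => ?_⟩
  · rw [← hνprob.measure_univ, ← hmap, Measure.map_apply hπc.measurable MeasurableSet.univ,
      Set.preimage_univ]
  · conv_rhs => rw [← hTmap]
    rw [Measure.map_apply hT.measurable hs]
  · have hcl : IsClosed (π '' Uᶜ) := (hU.isClosed_compl.isCompact.image hπc).isClosed
    have hne : (π '' Uᶜ)ᶜ.Nonempty := by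
      rw [Set.nonempty_compl]
      intro h
      have h1 := hirr _ hU.isClosed_compl h
      obtain ⟨x, hx⟩ := hUne
      have h2 : x ∈ Uᶜ := h1 ▸ Set.mem_univ x
      exact h2 hx
    have h1 := hνfull _ hcl.isOpen_compl hne
    rw [← hmap, Measure.map_apply hπc.measurable hcl.isOpen_compl.measurableSet] at h1
    refine h1.trans_le (measure_mono fun x hx => ?_)
    by_contra hxU
    exact hx ⟨x, hxU, rfl⟩
end

section
/- Let X and Y be compact metric spaces and π : X → Y a continuous surjection. Then the following are equivalent: (1) the set X₀ = {x ∈ X : π⁻¹(π(x)) = {x}} is a dense Gδ subset of X; (2) π is irreducible, i.e. for every closed subset Z ⊆ X, π(Z) = Y implies Z = X. -/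
open Filter Set Function Topology

/-- For a continuous surjection `π : X → Y` between compact metric spaces,
the set `X₀ = {x : π⁻¹(π x) = {x}}` is a dense `Gδ` subset of `X` iff `π` is irreducible
(every closed `Z ⊆ X` with `π(Z) = Y` equals `X`). -/
theorem denseGδ_singletonFibers_iff_irreducible
    {X Y : Type*} [MetricSpace X] [CompactSpace X] [MetricSpace Y] [CompactSpace Y]
    (π : X → Y) (hπc : Continuous π) (hπs : Function.Surjective π) :
    (Dense {x : X | π ⁻¹' {π x} = {x}} ∧ IsGδ {x : X | π ⁻¹' {π x} = {x}}) ↔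
      (∀ Z : Set X, IsClosed Z → π '' Z = Set.univ → Z = Set.univ) := by
  constructor
  · rintro ⟨hd, -⟩ Z hZ hZs
    have hsub : {x : X | π ⁻¹' {π x} = {x}} ⊆ Z := by
      intro x hx
      have h1 : π x ∈ π '' Z := by rw [hZs]; trivial
      obtain ⟨z, hz, hzx⟩ := h1
      have h2 : z ∈ π ⁻¹' {π x} := hzx
      rw [show π ⁻¹' {π x} = {x} from hx] at h2
      have h3 : z = x := h2
      exact h3 ▸ hz
    have := (hd.mono hsub).closure_eq
    rwa [hZ.closure_eq] at this
  · intro hirr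
    let A : ℕ → Set X := fun n => {x | ∃ x', π x' = π x ∧ 1 / ((n : ℝ) + 1) ≤ dist x x'}
    have hA : ∀ n, IsClosed (A n) := by
      intro n
      have hc : IsClosed {p : X × X | π p.2 = π p.1 ∧ 1 / ((n : ℝ) + 1) ≤ dist p.1 p.2} :=
        (isClosed_eq (hπc.comp continuous_snd) (hπc.comp continuous_fst)).inter
          (isClosed_le continuous_const continuous_dist)
      have := (hc.isCompact.image continuous_fst).isClosed
      convert this using 1
      ext x
      simp [A]
    have hX : {x : X | π ⁻¹' {π x} = {x}} = ⋂ n, (A n)ᶜ := by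
      ext x
      simp only [mem_ofPred_eq, mem_iInter, mem_compl_iff, A]
      constructor
      · rintro hx n ⟨x', h1, h2⟩
        have h3 : x' ∈ π ⁻¹' {π x} := h1
        rw [hx] at h3
        have h4 : x' = x := h3
        rw [h4, dist_self] at h2
        have : 0 < 1 / ((n : ℝ) + 1) := by positivity
        linarith
      · intro h
        ext x'
        constructor
        · intro hx'
          by_contra hne
          have hpos : 0 < dist x x' := dist_pos.2 (fun e => hne e.symm)
          obtain ⟨n, hn⟩ := exists_nat_one_div_lt hpos
          exact h n ⟨x', hx', hn.le⟩
        · intro e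
          have e' : x' = x := e
          rw [e']; rfl
    have hd : ∀ n, Dense (A n)ᶜ := by
      intro n
      rw [← interior_eq_empty_iff_dense_compl, eq_empty_iff_forall_notMem]
      intro x hx
      obtain ⟨r, hr, hball⟩ := Metric.isOpen_iff.1 isOpen_interior x hx
      have hpos : 0 < 1 / ((n : ℝ) + 1) := by positivity
      set s := min r (1 / ((n : ℝ) + 1) / 2) with hs
      have hs0 : 0 < s := lt_min hr (by positivity)
      have hsr : s ≤ r := min_le_left _ _
      have hsn : s ≤ 1 / ((n : ℝ) + 1) / 2 := min_le_right _ _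
      have hZ := hirr (Metric.ball x s)ᶜ Metric.isOpen_ball.isClosed_compl (by
        rw [eq_univ_iff_forall]
        intro y
        obtain ⟨z, rfl⟩ := hπs y
        by_cases hz : z ∈ Metric.ball x s
        · obtain ⟨z', h1, h2⟩ := interior_subset (hball (Metric.ball_subset_ball hsr hz))
          refine ⟨z', fun hz' => ?_, h1⟩
          rw [Metric.mem_ball] at hz hz'
          have := dist_triangle_right z z' x
          linarith
        · exact ⟨z, hz, rfl⟩)
      have : x ∈ (Metric.ball x s)ᶜ := by rw [hZ]; trivial
      exact this (Metric.mem_ball_self hs0)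
    rw [hX]
    exact ⟨dense_iInter_of_isOpen_nat (fun n => (hA n).isOpen_compl) hd,
      IsGδ.iInter_of_isOpen (fun n => (hA n).isOpen_compl)⟩
end

section
/- Let X be a separable infinite-dimensional complex Banach space and T : X → X a continuous linear operator which is hypercyclic. Suppose there is a subset D ⊆ X consisting of 𝕋-eigenvectors of T (vectors x ≠ 0 with T x = λ x for some λ ∈ ℂ with |λ| = 1) whose linear span is dense in X. Then T is syndetically hypercyclic: for every pair of nonempty open sets U,V ⊆ X the set N(U,V) = {n ∈ ℕ : T^n U ∩ V ≠ ∅} is syndetic. -/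
open Filter Set Function Topology

/-- Simultaneous powers of unimodular numbers return near `1` along a syndetic set. -/
lemma unimodular_return {n : ℕ} (l : Fin n → ℂ) (hl : ∀ i, ‖l i‖ = 1) {δ : ℝ} (hδ : 0 < δ) :
    ∃ K : ℕ, ∀ N : ℕ, ∃ m, N ≤ m ∧ m ≤ N + K ∧ ∀ i, ‖l i ^ m - 1‖ < δ := by
  have htb : TotallyBounded (range (fun k : ℕ => fun i => l i ^ k)) := by
    apply (isCompact_closedBall (0 : Fin n → ℂ) 1).totallyBounded.subset
    rintro _ ⟨k, rfl⟩
    rw [mem_closedBall_zero_iff, pi_norm_le_iff_of_nonneg zero_le_one]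
    intro i
    simp [hl]
  obtain ⟨t, hts, htf, hcov⟩ := Metric.finite_approx_of_totallyBounded htb δ hδ
  have hts2 : ∀ y, y ∈ t → ∃ k : ℕ, (fun i => l i ^ k) = y := fun y hy => hts hy
  choose! idx hidx using hts2
  obtain ⟨K, hK⟩ := (htf.image idx).bddAbove
  refine ⟨K, fun N => ?_⟩
  have h1 := hcov (mem_range_self (N + K))
  simp only [mem_iUnion] at h1
  obtain ⟨y, hy, hb⟩ := h1
  have hyK : idx y ≤ K := hK (mem_image_of_mem _ hy)
  refine ⟨N + K - idx y, by omega, by omega, fun i => ?_⟩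
  rw [Metric.mem_ball, ← hidx y hy, dist_pi_lt_iff hδ] at hb
  have h2 := hb i
  rw [dist_eq_norm] at h2
  have h3 : l i ^ (N + K) - l i ^ idx y = l i ^ idx y * (l i ^ (N + K - idx y) - 1) := by
    rw [mul_sub, ← pow_add, mul_one]
    congr 2
    omega
  simpa [h3, hl] using h2

/-- A hypercyclic operator on a separable infinite-dimensional complex
Banach space with a dense linear span of `𝕋`-eigenvectors is syndetically hypercyclic. -/
theorem syndeticallyHypercyclic_of_dense_unimodular_eigenvectors
    {X : Type*} [NormedAddCommGroup X] [NormedSpace ℂ X] [CompleteSpace X]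
    [TopologicalSpace.SeparableSpace X] (hinf : ¬ FiniteDimensional ℂ X)
    (T : X →L[ℂ] X)
    (htrans : ∀ U V : Set X, IsOpen U → U.Nonempty → IsOpen V → V.Nonempty →
      (hitSet (⇑T) U V).Nonempty)
    (D : Set X)
    (hD : ∀ x ∈ D, x ≠ 0 ∧ ∃ l : ℂ, ‖l‖ = 1 ∧ T x = l • x)
    (hspan : Dense ((Submodule.span ℂ D : Submodule ℂ X) : Set X)) :
    ∀ U V : Set X, IsOpen U → U.Nonempty → IsOpen V → V.Nonempty →
      IsSyndetic (hitSet (⇑T) U V) := by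
  intro U V hU hUn hV hVn
  obtain ⟨p, hp, _, ⟨u, hu, rfl⟩, huV⟩ := htrans U V hU hUn hV hVn
  have hcont : Continuous (⇑T)^[p] := T.continuous.iterate p
  have hW : IsOpen (U ∩ (⇑T)^[p] ⁻¹' V) := hU.inter (hV.preimage hcont)
  obtain ⟨x, hxW, hx⟩ := hspan.inter_open_nonempty _ hW ⟨u, hu, huV⟩
  obtain ⟨ε, hε, hball⟩ := Metric.isOpen_iff.1 hW x hxW
  obtain ⟨n, c, d, hsum⟩ := Submodule.mem_span_set'.1 hx
  choose l hl1 hl2 using fun i => (hD _ (d i).2).2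
  have hiter : ∀ k i, (⇑T)^[k] (d i : X) = l i ^ k • (d i : X) := by
    intro k i
    induction k with
    | zero => simp
    | succ k ih => rw [iterate_succ_apply', ih, map_smul, hl2, smul_smul, pow_succ]
  have hTx : ∀ k, (⇑T)^[k] x - x = ∑ i, (c i * (l i ^ k - 1)) • (d i : X) := by
    intro k
    have : (⇑T)^[k] x = (T ^ k) x := by rw [FunLike.coe_pow_eq_iterate]
    rw [this, ← hsum, map_sum, ← Finset.sum_sub_distrib]
    refine Finset.sum_congr rfl fun i _ => ?_
    rw [map_smul, FunLike.coe_pow_eq_iterate, hiter, smul_smul, ← sub_smul]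
    congr 1
    ring
  set S : ℝ := ∑ i, ‖c i‖ * ‖(d i : X)‖ with hS
  have hS0 : 0 ≤ S := Finset.sum_nonneg fun i _ => by positivity
  obtain ⟨K, hK⟩ := unimodular_return l hl1 (δ := ε / (S + 1)) (by positivity)
  refine ⟨K + p, fun N => ?_⟩
  obtain ⟨m, hNm, hmK, hm⟩ := hK N
  have hmem : (⇑T)^[m] x ∈ Metric.ball x ε := by
    rw [mem_ball_iff_norm, hTx]
    calc ‖∑ i, (c i * (l i ^ m - 1)) • (d i : X)‖
        ≤ ∑ i, (‖c i‖ * ‖(d i : X)‖) * (ε / (S + 1)) := by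
          refine norm_sum_le_of_le _ fun i _ => ?_
          rw [norm_smul, norm_mul, mul_right_comm]
          exact mul_le_mul_of_nonneg_left (hm i).le (by positivity)
      _ = S * (ε / (S + 1)) := by rw [← Finset.sum_mul]
      _ < ε := by
          rw [mul_div_assoc', div_lt_iff₀ (by positivity)]
          nlinarith
  refine ⟨p + m, ⟨by omega, _, ⟨x, hxW.1, rfl⟩, ?_⟩, by omega, by omega⟩
  rw [iterate_add_apply]
  exact (hball hmem).2
end

section
/- Let X be a separable infinite-dimensional Banach space and T : X → X a continuous linear operator which is chaotic: T is hypercyclic and the set of periodic points of T (points x with T^p x = x for some p ≥ 1) is dense in X. Then T is syndetically hypercyclic: for every pair of nonempty open sets U,V ⊆ X the set N(U,V) = {n ∈ ℕ : T^n U ∩ V ≠ ∅} is syndetic. -/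
open Filter Set Function Topology

/-- A chaotic operator (hypercyclic with dense periodic points) on a
separable infinite-dimensional Banach space is syndetically hypercyclic. -/
theorem chaotic_syndeticallyHypercyclic
    {X : Type*} [NormedAddCommGroup X] [NormedSpace ℂ X] [CompleteSpace X]
    [TopologicalSpace.SeparableSpace X] (hinf : ¬ FiniteDimensional ℂ X)
    (T : X →L[ℂ] X)
    (htrans : ∀ U V : Set X, IsOpen U → U.Nonempty → IsOpen V → V.Nonempty →
      (hitSet (⇑T) U V).Nonempty)
    (hper : Dense {x : X | ∃ p : ℕ, 1 ≤ p ∧ (⇑T)^[p] x = x}) :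
    ∀ U V : Set X, IsOpen U → U.Nonempty → IsOpen V → V.Nonempty →
      IsSyndetic (hitSet (⇑T) U V) := by
  intro U V hU hUn hV hVn
  obtain ⟨k, hk, y, ⟨u, huU, rfl⟩, hyV⟩ := htrans U V hU hUn hV hVn
  have hW : IsOpen (U ∩ (⇑T)^[k] ⁻¹' V) :=
    hU.inter (hV.preimage (T.continuous.iterate k))
  obtain ⟨x, ⟨hxU, hxV⟩, p, hp, hx⟩ := hper.inter_open_nonempty _ hW ⟨u, huU, hyV⟩
  refine ⟨k + p, fun n => ⟨k + p * (n / p + 1), ⟨by omega, _, ⟨x, hxU, rfl⟩, ?_⟩, ?_, ?_⟩⟩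
  · have h : IsPeriodicPt (⇑T) (p * (n / p + 1)) x := IsPeriodicPt.mul_const hx _
    rw [iterate_add_apply, h.eq]
    exact hxV
  · have := Nat.lt_mul_div_succ n (show 0 < p by omega)
    omega
  · have := Nat.mul_div_le n p
    rw [mul_add]
    omega
end

section
/- Let X be a separable infinite-dimensional Banach space and T : X → X a continuous linear operator which is frequently hypercyclic: there exists x₀ ∈ X such that for every nonempty open U ⊆ X the set N(x₀,U) = {n ∈ ℕ : T^n x₀ ∈ U} has positive lower density. Then T is weakly mixing: T × T is topologically transitive on X × X, i.e. for all nonempty open sets U₁,U₂,V₁,V₂ ⊆ X there exists n ∈ ℕ with T^n U₁ ∩ V₁ ≠ ∅ and T^n U₂ ∩ V₂ ≠ ∅. -/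
open Filter Set Function Topology

lemma fhc_density {A : Set ℕ} (h : 0 < lowerDensity A) :
    ∃ c : ℝ, 0 < c ∧ ∀ᶠ N : ℕ in atTop, c * N ≤ ((A ∩ Set.Icc 1 N).ncard : ℝ) := by
  refine ⟨lowerDensity A / 2, by linarith, ?_⟩
  have h1 : lowerDensity A / 2 < Filter.liminf
      (fun N : ℕ => ((A ∩ Set.Icc 1 N).ncard : ℝ) / N) Filter.atTop := by
    change _ < lowerDensity A
    linarith
  have hb : Filter.IsBoundedUnder (· ≥ ·) atTop
      (fun N : ℕ => ((A ∩ Set.Icc 1 N).ncard : ℝ) / N) :=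
    Filter.isBoundedUnder_of ⟨0, fun N => by positivity⟩
  have h2 := Filter.eventually_lt_of_lt_liminf h1 hb
  filter_upwards [h2, Filter.eventually_gt_atTop 0] with N hN hpos
  have : (0 : ℝ) < N := by exact_mod_cast hpos
  rw [lt_div_iff₀ this] at hN
  exact hN.le

lemma fhc_unbounded {A : Set ℕ} (h : 0 < lowerDensity A) (M : ℕ) : ∃ n ∈ A, M < n := by
  obtain ⟨c, hc, hev⟩ := fhc_density h
  by_contra! hA
  obtain ⟨K, hK⟩ := exists_nat_gt ((M : ℝ) / c)
  obtain ⟨N, hN, hNK⟩ := (hev.and (Filter.eventually_ge_atTop K)).exists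
  have h1 : (A ∩ Set.Icc 1 N).ncard ≤ M := by
    calc (A ∩ Set.Icc 1 N).ncard ≤ (Set.Icc 1 M).ncard :=
          Set.ncard_le_ncard (fun n hn => ⟨hn.2.1, hA n hn.1⟩) (Set.finite_Icc _ _)
      _ = M := by rw [← Finset.coe_Icc, Set.ncard_coe_finset]; simp
  have h2 : ((A ∩ Set.Icc 1 N).ncard : ℝ) ≤ M := by exact_mod_cast h1
  rw [div_lt_iff₀ hc] at hK
  have h3 : (K : ℝ) ≤ N := by exact_mod_cast hNK
  nlinarith

lemma fhc_delta {S : Set ℕ} (hS : ∀ M L : ℕ, ∃ a, M < a ∧ ∀ j ≤ L, a + j ∈ S) (K : ℕ) :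
    ∃ F : Finset ℕ, F.card = K ∧ ∀ x ∈ F, ∀ y ∈ F, x < y → y - x ∈ S := by
  induction K with
  | zero => exact ⟨∅, by simp, by simp⟩
  | succ K ih =>
    obtain ⟨F, hF, hd⟩ := ih
    obtain ⟨a, ha, haS⟩ := hS 0 (F.sup id)
    have hle : ∀ x ∈ F, x ≤ F.sup id := fun x hx => Finset.le_sup (f := id) hx
    have hn : a + F.sup id ∉ F := fun hx => by have := hle _ hx; omega
    refine ⟨insert (a + F.sup id) F, by rw [Finset.card_insert_of_notMem hn, hF], ?_⟩
    intro x hx y hy hxy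
    rw [Finset.mem_insert] at hx hy
    rcases hy with rfl | hy
    · rcases hx with rfl | hx
      · omega
      · have h1 := hle x hx
        have h2 := haS (F.sup id - x) (by omega)
        rwa [← Nat.add_sub_assoc h1] at h2
    · rcases hx with rfl | hx
      · have := hle y hy
        omega
      · exact hd x hx y hy hxy

lemma fhc_diff {A S : Set ℕ} (h : 0 < lowerDensity A)
    (hS : ∀ M L : ℕ, ∃ a, M < a ∧ ∀ j ≤ L, a + j ∈ S) :
    ∃ x ∈ A, ∃ y ∈ A, x ≤ y ∧ y - x ∈ S := by
  obtain ⟨c, hc, hev⟩ := fhc_density h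
  by_contra! hA
  obtain ⟨K, hK⟩ := exists_nat_gt (2 / c)
  obtain ⟨F, hF, hd⟩ := fhc_delta hS K
  have hle : ∀ x ∈ F, x ≤ F.sup id := fun x hx => Finset.le_sup (f := id) hx
  obtain ⟨N, hN, hNM⟩ := (hev.and (Filter.eventually_gt_atTop (F.sup id))).exists
  have hfin : (A ∩ Set.Icc 1 N).Finite := (Set.finite_Icc 1 N).inter_of_right A
  rw [Set.ncard_eq_toFinset_card _ hfin] at hN
  set B := hfin.toFinset with hB
  have hmem : ∀ b, b ∈ B → b ∈ A ∧ 1 ≤ b ∧ b ≤ N := fun b hb => by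
    have := hfin.mem_toFinset.1 hb
    exact ⟨this.1, this.2.1, this.2.2⟩
  have hcard : (F ×ˢ B).card ≤ (Finset.Icc 1 (N + F.sup id)).card := by
    refine Finset.card_le_card_of_injOn (fun p => p.1 + p.2) ?_ ?_
    · rintro ⟨s, b⟩ hp
      have hp := Finset.mem_product.1 hp
      have h1 := hle s hp.1
      have h2 := hmem b hp.2
      simp only [Finset.coe_Icc, Set.mem_Icc]
      omega
    · rintro ⟨s, a⟩ hp ⟨t, b⟩ hq heq
      have hp := Finset.mem_product.1 hp
      have hq := Finset.mem_product.1 hq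
      simp only at heq hp hq
      have h1 := hmem a hp.2
      have h2 := hmem b hq.2
      rcases lt_trichotomy s t with hst | hst | hst
      · have h3 := hd s hp.1 t hq.1 hst
        have h4 := hA b h2.1 a h1.1 (by omega)
        rw [show t - s = a - b by omega] at h3
        exact absurd h3 h4
      · have : a = b := by omega
        rw [hst, this]
      · have h3 := hd t hq.1 s hp.1 hst
        have h4 := hA a h1.1 b h2.1 (by omega)
        rw [show s - t = b - a by omega] at h3
        exact absurd h3 h4
  rw [Finset.card_product, hF, Nat.card_Icc] at hcard
  have h5 : (K : ℝ) * B.card ≤ N + N := by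
    have : K * B.card ≤ N + N := by omega
    exact_mod_cast this
  have hN0 : (0 : ℝ) < N := by
    have : 0 < N := by omega
    exact_mod_cast this
  rw [div_lt_iff₀ hc] at hK
  have h6 : (K : ℝ) * (c * N) ≤ K * B.card := by gcongr
  nlinarith

/-- A frequently hypercyclic operator on a separable infinite-dimensional
Banach space is topologically weakly mixing. -/
theorem frequentlyHypercyclic_weaklyMixing
    {X : Type*} [NormedAddCommGroup X] [NormedSpace ℂ X] [CompleteSpace X]
    [TopologicalSpace.SeparableSpace X] (hinf : ¬ FiniteDimensional ℂ X)
    (T : X →L[ℂ] X) (x₀ : X)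
    (hFH : ∀ U : Set X, IsOpen U → U.Nonempty →
      0 < lowerDensity (hitSetPt (⇑T) x₀ U)) :
    ∀ U₁ U₂ V₁ V₂ : Set X,
      IsOpen U₁ → U₁.Nonempty → IsOpen U₂ → U₂.Nonempty →
      IsOpen V₁ → V₁.Nonempty → IsOpen V₂ → V₂.Nonempty →
      ∃ n : ℕ, 0 < n ∧ ((⇑T)^[n] '' U₁ ∩ V₁).Nonempty ∧
        ((⇑T)^[n] '' U₂ ∩ V₂).Nonempty := by
  intro U₁ U₂ V₁ V₂ hU₁ nU₁ hU₂ nU₂ hV₁ nV₁ hV₂ nV₂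
  have hit : ∀ U : Set X, IsOpen U → U.Nonempty → ∀ M : ℕ, ∃ n, M < n ∧ (⇑T)^[n] x₀ ∈ U := by
    intro U hU nU M
    obtain ⟨n, hn, hM⟩ := fhc_unbounded (hFH U hU nU) M
    exact ⟨n, hM, hn.2⟩
  have hcont : ∀ n, Continuous ((⇑T)^[n]) := fun n => T.continuous.iterate n
  have hzero : ∀ n, (⇑T)^[n] 0 = 0 := fun n => iterate_map_zero T n
  have hadd : ∀ n (x y : X), (⇑T)^[n] (x + y) = (⇑T)^[n] x + (⇑T)^[n] y :=
    fun n x y => iterate_map_add T n x y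
  obtain ⟨a, -, ha⟩ := hit U₁ hU₁ nU₁ 0
  obtain ⟨b, -, hb⟩ := hit U₂ hU₂ nU₂ 0
  obtain ⟨v₁, hv₁⟩ := nV₁
  obtain ⟨v₂, hv₂⟩ := nV₂
  obtain ⟨e₁, he₁, hB₁⟩ := Metric.isOpen_iff.1 hU₁ _ ha
  obtain ⟨e₂, he₂, hB₂⟩ := Metric.isOpen_iff.1 hU₂ _ hb
  obtain ⟨e₃, he₃, hB₃⟩ := Metric.isOpen_iff.1 hV₁ _ hv₁
  obtain ⟨e₄, he₄, hB₄⟩ := Metric.isOpen_iff.1 hV₂ _ hv₂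
  obtain ⟨e, he, h1, h2, h3, h4⟩ : ∃ e : ℝ, 0 < e ∧ e ≤ e₁ ∧ e ≤ e₂ ∧ e + e ≤ e₃ ∧ e + e ≤ e₄ := by
    refine ⟨min (min e₁ e₂) (min (e₃ / 2) (e₄ / 2)), by positivity, ?_, ?_, ?_, ?_⟩
    · exact (min_le_left _ _).trans (min_le_left _ _)
    · exact (min_le_left _ _).trans (min_le_right _ _)
    · have := (min_le_right (min e₁ e₂) (min (e₃ / 2) (e₄ / 2))).trans (min_le_left _ _)
      linarith
    · have := (min_le_right (min e₁ e₂) (min (e₃ / 2) (e₄ / 2))).trans (min_le_right _ _)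
      linarith
  have comb : ∀ (u v w : X) (d d' : ℝ) (U V : Set X) (n : ℕ), Metric.ball u d ⊆ U →
      Metric.ball v d' ⊆ V → e ≤ d → e + e ≤ d' → (⇑T)^[n] u ∈ Metric.ball (0 : X) e →
      w ∈ Metric.ball (0 : X) e → (⇑T)^[n] w ∈ Metric.ball v e →
      ((⇑T)^[n] '' U ∩ V).Nonempty := by
    intro u v w d d' U V n hU hV hd hd' hu hw hv
    refine ⟨(⇑T)^[n] (u + w), ⟨u + w, hU ?_, rfl⟩, hV ?_⟩
    · rw [mem_ball_zero_iff] at hw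
      rw [mem_ball_iff_norm, add_sub_cancel_left]
      linarith
    · rw [mem_ball_zero_iff] at hu
      rw [mem_ball_iff_norm] at hv ⊢
      rw [hadd, add_sub_assoc]
      have := norm_add_le ((⇑T)^[n] u) ((⇑T)^[n] w - v)
      linarith
  set W : Set X := Metric.ball 0 e with hW
  have oW : IsOpen W := Metric.isOpen_ball
  have W0 : (0 : X) ∈ W := Metric.mem_ball_self he
  -- the set of times at which both base points are near zero is thick
  have thick : ∀ M L : ℕ, ∃ q, M < q ∧ ∀ j ≤ L,
      (⇑T)^[q + j + a] x₀ ∈ W ∧ (⇑T)^[q + j + b] x₀ ∈ W := by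
    intro M L
    have ho : IsOpen (⋂ j ∈ Finset.range (L + a + b + 1), (⇑T)^[j] ⁻¹' W) :=
      isOpen_biInter_finset fun j _ => oW.preimage (hcont j)
    have hne : (⋂ j ∈ Finset.range (L + a + b + 1), (⇑T)^[j] ⁻¹' W).Nonempty := by
      refine ⟨0, Set.mem_iInter₂.2 fun j _ => ?_⟩
      rw [Set.mem_preimage, hzero]
      exact W0
    obtain ⟨q, hq, hqm⟩ := hit _ ho hne M
    have key : ∀ j < L + a + b + 1, (⇑T)^[q + j] x₀ ∈ W := by
      intro j hj
      have := Set.mem_iInter₂.1 hqm j (Finset.mem_range.2 hj)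
      rw [Set.mem_preimage, ← Function.iterate_add_apply] at this
      rwa [add_comm]
    refine ⟨q, hq, fun j hj => ⟨?_, ?_⟩⟩
    · rw [add_assoc]
      exact key _ (by omega)
    · rw [add_assoc]
      exact key _ (by omega)
  obtain ⟨p, -, hp⟩ := hit (Metric.ball v₁ e) Metric.isOpen_ball ⟨v₁, Metric.mem_ball_self he⟩ 0
  obtain ⟨p', hpp, hp'⟩ :=
    hit (Metric.ball v₂ e) Metric.isOpen_ball ⟨v₂, Metric.mem_ball_self he⟩ p
  obtain ⟨m, rfl⟩ : ∃ m, p' = m + p := ⟨p' - p, by omega⟩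
  rw [Function.iterate_add_apply] at hp'
  set V : Set X := Metric.ball v₁ e ∩ (⇑T)^[m] ⁻¹' Metric.ball v₂ e with hV
  have oV : IsOpen V := Metric.isOpen_ball.inter (Metric.isOpen_ball.preimage (hcont m))
  set W' : Set X := W ∩ (⇑T)^[m] ⁻¹' W with hW'
  have oW' : IsOpen W' := oW.inter (oW.preimage (hcont m))
  obtain ⟨q, -, hq⟩ := hit W' oW' ⟨0, W0, by rw [Set.mem_preimage, hzero]; exact W0⟩ 0
  obtain ⟨r, hqr, hr⟩ := hit V oV ⟨_, hp, hp'⟩ q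
  obtain ⟨k, rfl⟩ : ∃ k, r = k + q := ⟨r - q, by omega⟩
  rw [Function.iterate_add_apply] at hr
  obtain ⟨x, hx, y, hy, hxy, -, hS1, hS2⟩ := fhc_diff
    (S := {n | 0 < n ∧ (⇑T)^[n + k + a] x₀ ∈ W ∧ (⇑T)^[n + k + b] x₀ ∈ W})
    (hFH (W' ∩ (⇑T)^[k] ⁻¹' V) (oW'.inter (oV.preimage (hcont k))) ⟨_, hq, hr⟩) (by
      intro M L
      obtain ⟨q, hq, h⟩ := thick (M + k) L
      refine ⟨q - k, by omega, fun j hj => ⟨by omega, ?_⟩⟩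
      rw [show q - k + j + k = q + j by omega]
      exact h j hj)
  obtain ⟨n, rfl⟩ : ∃ n, y = n + x := ⟨y - x, by omega⟩
  rw [Nat.add_sub_cancel] at hS1 hS2
  have hw := hx.2.1
  have hTv : (⇑T)^[n + k] ((⇑T)^[x] x₀) ∈ V := by
    have := hy.2.2
    rw [Set.mem_preimage, ← Function.iterate_add_apply] at this
    rw [← Function.iterate_add_apply]
    rwa [show n + k + x = k + (n + x) by omega]
  have hk : 0 < k := by omega
  refine ⟨n + k, by omega, ?_, ?_⟩
  · refine comb _ v₁ _ e₁ e₃ U₁ V₁ (n + k) hB₁ hB₃ h1 h3 ?_ hw.1 hTv.1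
    rw [← Function.iterate_add_apply]
    exact hS1
  · refine comb _ v₂ _ e₂ e₄ U₂ V₂ (n + k) hB₂ hB₄ h2 h4 ?_ hw.2 ?_
    · rw [← Function.iterate_add_apply]
      exact hS2
    · have := hTv.2
      rw [Set.mem_preimage, ← Function.iterate_add_apply] at this
      rw [← Function.iterate_add_apply, add_comm (n + k) m]
      exact this
end

section
/- Let X be a separable infinite-dimensional Banach space and T : X → X a continuous linear operator which is frequently hypercyclic: there exists x₀ ∈ X such that for every nonempty open U ⊆ X the set N(x₀,U) = {n ∈ ℕ : T^n x₀ ∈ U} has positive lower density. Then for every dynamical compactification J : X → X̃ of the system (X,T), with compact metric system (X̃,T̃), there exists a T̃-invariant Borel probability measure on X̃ with full support; i.e. every frequently hypercyclic operator is an E-system. -/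
open Filter Set Function Topology MeasureTheory

/-- The empirical measure of the first `N + 1` points of the orbit of `y` under `S`. -/
noncomputable def empMeas {Y : Type*} [MeasurableSpace Y] (S : Y → Y) (y : Y) (N : ℕ) :
    Measure Y :=
  ((N + 1 : ℕ) : ENNReal)⁻¹ • ∑ i ∈ Finset.Icc 1 (N + 1), Measure.dirac (S^[i] y)

lemma empMeas_prob {Y : Type*} [MeasurableSpace Y] (S : Y → Y) (y : Y) (N : ℕ) :
    IsProbabilityMeasure (empMeas S y N) := by
  constructor
  simp only [empMeas, Measure.smul_apply, Measure.finsetSum_apply, measure_univ,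
    Finset.sum_const, Nat.card_Icc, smul_eq_mul, nsmul_eq_mul, mul_one, Nat.add_sub_cancel]
  exact ENNReal.inv_mul_cancel (by simp) (ENNReal.natCast_ne_top _)

lemma empMeas_ge {Y : Type*} [MeasurableSpace Y] (S : Y → Y) (y : Y) (N : ℕ)
    (F : Set Y) (hF : MeasurableSet F) :
    ENNReal.ofReal (((hitSetPt S y F ∩ Set.Icc 1 (N + 1)).ncard : ℝ) / ((N + 1 : ℕ) : ℝ))
      ≤ empMeas S y N F := by
  classical
  have h1 : hitSetPt S y F ∩ Set.Icc 1 (N + 1)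
      = ((Finset.Icc 1 (N + 1)).filter (fun i => S^[i] y ∈ F) : Finset ℕ) := by
    ext i
    simp only [hitSetPt, Set.mem_inter_iff, Set.mem_setOf_eq, Set.mem_Icc, Finset.coe_filter,
      Finset.mem_Icc]
    constructor
    · rintro ⟨⟨_, a⟩, b⟩; exact ⟨b, a⟩
    · rintro ⟨b, a⟩; exact ⟨⟨by omega, a⟩, b⟩
  rw [h1, Set.ncard_coe_finset, ENNReal.ofReal_div_of_pos (by positivity),
    ENNReal.ofReal_natCast, ENNReal.ofReal_natCast]
  simp only [empMeas, Measure.smul_apply, Measure.finsetSum_apply, smul_eq_mul,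
    Measure.dirac_apply' _ hF, Set.indicator_apply, Pi.one_apply]
  rw [Finset.sum_boole, ENNReal.div_eq_inv_mul]

lemma empMeas_integral {Y : Type*} [TopologicalSpace Y] [MeasurableSpace Y] [BorelSpace Y]
    (S : Y → Y) (y : Y) (N : ℕ) (f : BoundedContinuousFunction Y ℝ) :
    ∫ x, f x ∂(empMeas S y N)
      = ((N + 1 : ℕ) : ℝ)⁻¹ * ∑ i ∈ Finset.Icc 1 (N + 1), f (S^[i] y) := by
  rw [empMeas, integral_smul_measure, integral_finsetSum_measure]
  · simp only [ENNReal.toReal_inv, ENNReal.toReal_natCast, smul_eq_mul]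
    congr 1
    refine Finset.sum_congr rfl fun i _ => ?_
    exact integral_dirac' _ _ f.continuous.measurable.stronglyMeasurable
  · intro i _
    exact f.integrable _

theorem frequentlyHypercyclic_E_system
    {X Y : Type*} [NormedAddCommGroup X] [NormedSpace ℂ X] [CompleteSpace X]
    [TopologicalSpace.SeparableSpace X] (hinf : ¬ FiniteDimensional ℂ X)
    [MetricSpace Y] [CompactSpace Y] [MeasurableSpace Y] [BorelSpace Y]
    (T : X →L[ℂ] X) (x₀ : X)
    (hFH : ∀ U : Set X, IsOpen U → U.Nonempty →
      0 < lowerDensity (hitSetPt (⇑T) x₀ U))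
    (S : Y → Y) (hS : Continuous S)
    (J : X → Y) (hJ : IsEmbedding J) (hJdense : DenseRange J)
    (hequi : ∀ x : X, S (J x) = J (T x)) :
    ∃ μ : Measure Y, IsProbabilityMeasure μ ∧
      (∀ s : Set Y, MeasurableSet s → μ (S ⁻¹' s) = μ s) ∧
      (∀ V : Set Y, IsOpen V → V.Nonempty → 0 < μ V) := by
  have hiter : ∀ n : ℕ, S^[n] (J x₀) = J ((⇑T)^[n] x₀) := by
    intro n
    induction n with
    | zero => rfl
    | succ k ih => rw [Function.iterate_succ_apply', Function.iterate_succ_apply', ih, hequi]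
  set y := J x₀ with hy
  let m : ℕ → ProbabilityMeasure Y := fun N => ⟨empMeas S y N, empMeas_prob S y N⟩
  let L : Filter ℕ := (Ultrafilter.of (atTop : Filter ℕ) : Ultrafilter ℕ)
  have hL : L ≤ atTop := Ultrafilter.of_le _
  obtain ⟨μ, -, hμ⟩ := isCompact_univ.ultrafilter_le_nhds
    ((Ultrafilter.of (atTop : Filter ℕ)).map m) (by simp)
  have hm : Tendsto m L (𝓝 μ) := hμ
  have hLne : L.NeBot := Ultrafilter.neBot _
  refine ⟨μ, inferInstance, ?_, ?_⟩
  · have hmap : (μ : Measure Y).map S = μ := by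
      have : IsProbabilityMeasure ((μ : Measure Y).map S) :=
        Measure.isProbabilityMeasure_map hS.measurable.aemeasurable
      apply ext_of_forall_integral_eq_of_IsFiniteMeasure
      intro f
      rw [integral_map hS.measurable.aemeasurable f.continuous.aestronglyMeasurable]
      have hI := ProbabilityMeasure.tendsto_iff_forall_integral_tendsto.1 hm
      have h1 := hI f
      have h2 := hI (f.compContinuous ⟨S, hS⟩)
      have h3 := h2.sub h1
      have h0 : Tendsto (fun N : ℕ => ∫ x, (f.compContinuous ⟨S, hS⟩) x ∂(m N : Measure Y)
          - ∫ x, f x ∂(m N : Measure Y)) L (𝓝 0) := by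
        refine Tendsto.mono_left ?_ hL
        have hb : Tendsto (fun N : ℕ => (2 * ‖f‖) * (1 / ((N : ℝ) + 1))) atTop (𝓝 0) := by
          simpa using (tendsto_one_div_add_atTop_nhds_zero_nat (𝕜 := ℝ)).const_mul (2 * ‖f‖)
        refine squeeze_zero_norm (fun N => ?_) hb
        change ‖∫ x, (f.compContinuous ⟨S, hS⟩) x ∂(empMeas S y N)
          - ∫ x, f x ∂(empMeas S y N)‖ ≤ _
        rw [empMeas_integral, empMeas_integral, ← mul_sub, ← Finset.sum_sub_distrib]
        have : ∑ i ∈ Finset.Icc 1 (N + 1), ((f.compContinuous ⟨S, hS⟩) (S^[i] y) - f (S^[i] y))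
            = f (S^[N + 2] y) - f (S^[1] y) := by
          have key : ∀ M : ℕ, ∑ i ∈ Finset.Icc 1 M,
              ((f.compContinuous ⟨S, hS⟩) (S^[i] y) - f (S^[i] y))
              = f (S^[M + 1] y) - f (S^[1] y) := by
            intro M
            induction M with
            | zero => simp
            | succ k ih =>
              rw [Finset.sum_Icc_succ_top (by omega), ih]
              have : (f.compContinuous ⟨S, hS⟩) (S^[k + 1] y) = f (S^[k + 1 + 1] y) := by
                rw [Function.iterate_succ_apply' S (k + 1)]; rfl
              rw [this]; ring
          exact key (N + 1)
        rw [this, norm_mul, norm_inv, Real.norm_natCast, mul_comm, one_div]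
        push_cast
        gcongr
        calc _ ≤ ‖f (S^[N + 2] y)‖ + ‖f (S^[1] y)‖ := norm_sub_le _ _
          _ ≤ ‖f‖ + ‖f‖ := add_le_add (f.norm_coe_le_norm _) (f.norm_coe_le_norm _)
          _ = 2 * ‖f‖ := by ring
      have := tendsto_nhds_unique h3 h0
      exact sub_eq_zero.1 this
    intro s hs
    rw [← Measure.map_apply hS.measurable hs, hmap]
  · intro V hV hVne
    obtain ⟨v, hv⟩ := hVne
    obtain ⟨r, hr, hrV⟩ := Metric.nhds_basis_closedBall.mem_iff.1 (hV.mem_nhds hv)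
    obtain ⟨x, hx⟩ := hJdense.exists_mem_open Metric.isOpen_ball ⟨v, Metric.mem_ball_self hr⟩
    have hd := hFH (J ⁻¹' Metric.ball v r) (Metric.isOpen_ball.preimage hJ.continuous) ⟨x, hx⟩
    obtain ⟨c, hc0, hc⟩ := exists_between hd
    have hev := eventually_lt_of_lt_liminf hc
      (isBoundedUnder_of ⟨0, fun N => by positivity⟩)
    have hev' : ∀ᶠ N in L, ENNReal.ofReal c ≤ (m N : Measure Y) (Metric.closedBall v r) := by
      refine hL ?_
      filter_upwards [(tendsto_add_atTop_nat 1).eventually hev] with N hN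
      refine le_trans (ENNReal.ofReal_le_ofReal ?_)
        (empMeas_ge S y N _ Metric.isClosed_closedBall.measurableSet)
      refine hN.le.trans ?_
      gcongr
      · exact (Set.finite_Icc 1 (N + 1)).inter_of_right _
      · rintro n ⟨hn, hn'⟩
        refine ⟨hn, ?_⟩
        rw [hiter]
        exact Metric.ball_subset_closedBall hn'
    have hle := ProbabilityMeasure.limsup_measure_closed_le_of_tendsto hm
      (Metric.isClosed_closedBall (x := v) (ε := r))
    have hge := le_limsup_of_frequently_le hev'.frequently
    exact (ENNReal.ofReal_pos.2 hc0).trans_le ((hge.trans hle).trans (measure_mono hrV))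
end
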